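/- arXiv:2012.08482 — 6 statements merged into one kernel-verified Lean document; each statement's English description precedes it below -/
import Mathlib

section
/- Let X ⊆ ℝ be a countable set and let f be an arbitrary real-valued function defined on finite multisets with elements from X. Then there exist a function φ : ℝ → ℝ with range contained in [0,1], a function ρ : ℝ → ℝ, and LAF parameters a,b,c,d,e,f',g,h ≥ 0 and α,β,γ,δ ∈ ℝ, such that for every finite multiset m all of whose elements lie in X, the denominator γ·L_{e,f'}(φm) + δ·L_{g,h}(1−φm) is nonzero and f(m) = ρ(LAF(φm)), where φm denotes the multiset {φ(x) : x ∈ m} (with multiplicities preserved). -/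
open Real

/-- `L_{a,b}(m) = (∑_{x ∈ m} x^b)^a`, powers being real powers (`rpow`). -/
noncomputable def Lab (a b : ℝ) (m : Multiset ℝ) : ℝ :=
  ((m.map fun x => x ^ b).sum) ^ a

/-- The learnable aggregation function (LAF). -/
noncomputable def LAF (a b c d e f g h α β γ δ : ℝ) (m : Multiset ℝ) : ℝ :=
  (α * Lab a b m + β * Lab c d (m.map fun x => 1 - x)) /
    (γ * Lab e f m + δ * Lab g h (m.map fun x => 1 - x))

/-- There is a transcendental real number strictly between `0` and `1`. -/
lemma exists_transcendental_mem_Ioo : ∃ t ∈ Set.Ioo (0 : ℝ) 1, Transcendental ℤ t := by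
  obtain ⟨t, ht, h⟩ := ((Algebraic.countable ℤ ℝ).dense_compl ℝ).exists_mem_open
    isOpen_Ioo (Set.nonempty_Ioo.2 (zero_lt_one' ℝ))
  exact ⟨t, h, ht⟩

/-- A finite multiset of exponents is determined by the sum of the corresponding powers of a
transcendental number. -/
lemma Transcendental.injective_sum_map_pow {A : Type*} [CommRing A] {t : A}
    (ht : Transcendental ℤ t) :
    Function.Injective fun s : Multiset ℕ => (s.map fun n => t ^ n).sum := by
  have aeval_sum (s : Multiset ℕ) :
      Polynomial.aeval t (s.map fun n => (Polynomial.X : Polynomial ℤ) ^ n).sum =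
        (s.map fun n => t ^ n).sum := by
    simp [map_multiset_sum, Multiset.map_map]
  have coeff_sum (s : Multiset ℕ) (k : ℕ) :
      (s.map fun n => (Polynomial.X : Polynomial ℤ) ^ n).sum.coeff k = s.count k := by
    induction s using Multiset.induction_on with
    | empty => simp
    | cons n s ih =>
      simp only [Multiset.map_cons, Multiset.sum_cons, Polynomial.coeff_add, ih,
        Polynomial.coeff_X_pow, Multiset.count_cons]
      split_ifs <;> push_cast <;> ring
  intro s s' h
  have hp := transcendental_iff_injective.1 ht ((aeval_sum s).trans (h.trans (aeval_sum s').symm))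
  ext k
  exact_mod_cast (coeff_sum s k).symm.trans ((congrArg (·.coeff k) hp).trans (coeff_sum s' k))

/-- Mapping a function over multisets is injective on the multisets whose elements lie in a set
on which the function is injective. -/
lemma Set.InjOn.multiset_map {α β : Type*} {f : α → β} {s : Set α} (hf : s.InjOn f) :
    {m : Multiset α | ∀ x ∈ m, x ∈ s}.InjOn (Multiset.map f) := by
  intro m hm m' hm' h
  cases isEmpty_or_nonempty α
  · exact (Multiset.eq_zero_of_forall_notMem fun x => isEmptyElim x).trans
      (Multiset.eq_zero_of_forall_notMem fun x => isEmptyElim x).symm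
  have map_inv {n : Multiset α} (hn : ∀ x ∈ n, x ∈ s) :
      (n.map f).map (Function.invFunOn f s) = n := by
    rw [Multiset.map_map]
    exact (Multiset.map_congr rfl fun x hx => hf.leftInvOn_invFunOn (hn x hx)).trans n.map_id
  rw [← map_inv hm, h, map_inv hm']

/-- Proposition 1: every function on finite multisets over a countable domain `X ⊆ ℝ`
can be represented as `ρ ∘ LAF ∘ φ` with an encoder `φ` taking values in `[0,1]` and
nonnegative LAF exponent parameters, the LAF denominator being nonzero on the relevant sets. -/
theorem laf_universal_representation (X : Set ℝ) (hX : X.Countable)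
    (F : Multiset ℝ → ℝ) :
    ∃ (φ ρ : ℝ → ℝ) (a b c d e f g h α β γ δ : ℝ),
      Set.range φ ⊆ Set.Icc (0 : ℝ) 1 ∧
      0 ≤ a ∧ 0 ≤ b ∧ 0 ≤ c ∧ 0 ≤ d ∧ 0 ≤ e ∧ 0 ≤ f ∧ 0 ≤ g ∧ 0 ≤ h ∧
      ∀ m : Multiset ℝ, (∀ x ∈ m, x ∈ X) →
        (γ * Lab e f (m.map φ) + δ * Lab g h ((m.map φ).map fun x => 1 - x) ≠ 0) ∧
        F m = ρ (LAF a b c d e f g h α β γ δ (m.map φ)) := by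
  obtain ⟨t, ⟨ht0, ht1⟩, ht⟩ := exists_transcendental_mem_Ioo
  obtain ⟨enc, henc⟩ := Set.countable_iff_exists_injOn.1 hX
  set S : Multiset ℝ → ℝ := fun m => ((m.map enc).map fun n => t ^ n).sum with hS
  have hinj : {m : Multiset ℝ | ∀ x ∈ m, x ∈ X}.InjOn S :=
    ht.injective_sum_map_pow.comp_injOn henc.multiset_map
  refine ⟨fun x => t ^ enc x, fun y => F (Function.invFunOn S {m | ∀ x ∈ m, x ∈ X} y),
    1, 1, 0, 0, 0, 0, 0, 0, 1, 0, 1, 0, ?_, by simp, by simp, le_rfl, le_rfl, le_rfl, le_rfl,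
    le_rfl, le_rfl, fun m hm => ⟨by simp [Lab], ?_⟩⟩
  · rintro _ ⟨x, rfl⟩
    exact ⟨by positivity, pow_le_one₀ ht0.le ht1.le⟩
  · have hLAF : LAF 1 1 0 0 0 0 0 0 1 0 1 0 (m.map fun x => t ^ enc x) = S m := by
      simp [LAF, Lab, hS, Multiset.map_map]
    simp only [hLAF]
    rw [hinj.leftInvOn_invFunOn hm]
end

section
/- For every countable set X ⊆ ℝ there exists a function φ : ℝ → ℝ with range contained in [0,1] such that the sum-aggregation map m ↦ ∑_{x∈m} φ(x) (sum taken over the multiset with multiplicity) is injective on the collection of finite multisets all of whose elements lie in X; that is, if m and m' are finite multisets with elements in X and ∑_{x∈m} φ(x) = ∑_{x∈m'} φ(x), then m = m'. -/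
open Polynomial in
/-- The coefficients of `∑_{k ∈ s} X ^ k` are the multiplicities of `s`. -/
theorem Multiset.coeff_sum_map_X_pow (s : Multiset ℕ) (n : ℕ) :
    ((s.map fun k => (X : ℤ[X]) ^ k).sum).coeff n = s.count n := by
  induction s using Multiset.induction_on with
  | empty => simp
  | cons a s ih =>
    rw [Multiset.map_cons, Multiset.sum_cons, coeff_add, ih, coeff_X_pow, Multiset.count_cons]
    push_cast
    ring

/-- A finite multiset of exponents is determined by its sum of powers of a transcendental. -/
theorem Transcendental.sum_map_pow_injective {R : Type*} [CommRing R] {t : R}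
    (ht : Transcendental ℤ t) :
    Function.Injective fun s : Multiset ℕ => (s.map fun k => t ^ k).sum := by
  intro s s' h
  have key (u : Multiset ℕ) : (u.map fun k => t ^ k).sum =
      Polynomial.aeval t (u.map fun k => (Polynomial.X : Polynomial ℤ) ^ k).sum := by
    simp [map_multiset_sum, Multiset.map_map]
  have hp := transcendental_iff_injective.mp ht (((key s).symm.trans h).trans (key s'))
  ext n
  have hn := congrArg (fun p => Polynomial.coeff p n) hp
  simpa only [Multiset.coeff_sum_map_X_pow, Nat.cast_inj] using hn

theorem exists_transcendental_mem_Icc : ∃ t ∈ Set.Icc (0 : ℝ) 1, Transcendental ℤ t := by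
  refine ⟨Int.fract (liouvilleNumber 2), ⟨Int.fract_nonneg _, (Int.fract_lt_one _).le⟩, fun h => ?_⟩
  refine transcendental_liouvilleNumber (m := 2) le_rfl ?_
  have hsum := h.add (isAlgebraic_algebraMap (A := ℝ) ⌊liouvilleNumber 2⌋)
  simpa using hsum

/-- Encoding lemma for Proposition 1: over any countable `X ⊆ ℝ` there is an encoder
`φ : ℝ → ℝ` with values in `[0,1]` such that sum-aggregation `m ↦ ∑_{x ∈ m} φ(x)`
is injective on finite multisets with elements from `X`. -/
theorem exists_encoder_sum_injective (X : Set ℝ) (hX : X.Countable) :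
    ∃ φ : ℝ → ℝ, Set.range φ ⊆ Set.Icc (0 : ℝ) 1 ∧
      ∀ m m' : Multiset ℝ, (∀ x ∈ m, x ∈ X) → (∀ x ∈ m', x ∈ X) →
        (m.map φ).sum = (m'.map φ).sum → m = m' := by
  obtain ⟨t, ⟨ht0, ht1⟩, ht⟩ := exists_transcendental_mem_Icc
  obtain ⟨e, he⟩ := Set.countable_iff_exists_injOn.mp hX
  refine ⟨fun x => t ^ e x, ?_, fun m m' hm hm' h => ?_⟩
  · rintro _ ⟨x, rfl⟩
    exact ⟨pow_nonneg ht0 _, pow_le_one₀ ht0 ht1⟩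
  · have hmap : m.map e = m'.map e :=
      ht.sum_map_pow_injective (by simpa only [Multiset.map_map, Function.comp_def] using h)
    have hinv (u : Multiset ℝ) (hu : ∀ x ∈ u, x ∈ X) :
        (u.map e).map (Function.invFunOn e X) = u := by
      rw [Multiset.map_map]
      exact (Multiset.map_congr rfl fun x hx => he.leftInvOn_invFunOn (hu x hx)).trans
        (Multiset.map_id u)
    rw [← hinv m hm, hmap, hinv m' hm']
end

section
/- Let μ be the countable product over ℕ of copies of the uniform probability measure on [0,1] (a probability measure on ℕ → ℝ). Then for μ-almost every r : ℕ → ℝ, the map sending each finitely supported function a : ℕ → ℕ to the real number ∑_{n} (a n) · r n is injective on finitely supported functions; that is, almost surely, distinct multiplicity vectors a ≠ a' yield ∑_n a n · r n ≠ ∑_n a' n · r n. -/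
open MeasureTheory

/-- If the cylinder probabilities of `μ` are products of uniform probabilities on `[0,1]`, then
every finite-dimensional marginal of `μ` is absolutely continuous. -/
theorem map_restrict_absolutelyContinuous_volume {ι : Type*} {μ : Measure (ι → ℝ)}
    (hμ : ∀ s : Finset ι, ∀ t : ι → Set ℝ, (∀ i, MeasurableSet (t i)) →
      μ {r : ι → ℝ | ∀ i ∈ s, r i ∈ t i} =
        ∏ i ∈ s, volume.restrict (Set.Icc (0 : ℝ) 1) (t i)) (s : Finset ι) :
    μ.map s.restrict ≪ volume := by
  classical
  have h_pi : Measure.pi (fun _ : s => volume.restrict (Set.Icc (0 : ℝ) 1)) =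
      μ.map s.restrict := by
    refine Measure.pi_eq fun t ht => ?_
    rw [Measure.map_apply (by fun_prop) (.univ_pi ht)]
    have h := hμ s (fun i => if hi : i ∈ s then t ⟨i, hi⟩ else Set.univ) fun i => by
      split_ifs
      exacts [ht _, .univ]
    rw [← Finset.prod_coe_sort] at h
    simp only [Finset.coe_mem, dite_true, Subtype.coe_eta] at h
    rw [← h]
    congr 1
    ext r
    simp +contextual [Set.mem_pi]
  rw [← h_pi, ← Measure.restrict_pi_pi]
  exact Measure.absolutelyContinuous_of_le Measure.restrict_le_self

/-- A nontrivial linear form on a finite-dimensional real space is almost everywhere nonzero. -/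
theorem ae_sum_mul_ne_zero {ι : Type*} [Fintype ι] {d : ι → ℝ} (hd : d ≠ 0) :
    ∀ᵐ x : ι → ℝ, ∑ i, d i * x i ≠ 0 := by
  classical
  let L : (ι → ℝ) →ₗ[ℝ] ℝ := ∑ i, d i • LinearMap.proj i
  have hL (x : ι → ℝ) : L x = ∑ i, d i * x i := by simp [L]
  have h_ker : LinearMap.ker L ≠ ⊤ := fun h => hd <| funext fun i => by
    have hi : L (Pi.single i 1) = 0 := by simp [LinearMap.ker_eq_top.mp h]
    simpa [hL, Pi.single_apply] using hi
  filter_upwards [measure_eq_zero_iff_ae_notMem.mp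
    (Measure.addHaar_submodule volume (LinearMap.ker L) h_ker)] with x hx
  simpa [hL] using hx

/-- Almost-sure injectivity of sum-aggregation: let `μ` be the countable product over `ℕ` of
copies of the uniform probability measure on `[0,1]` (characterized here, since this Mathlib
version has no infinite-product-measure constructor, as the unique probability measure on
`ℕ → ℝ` whose finite-dimensional cylinder probabilities are the corresponding products of
uniform `[0,1]` probabilities). Then for `μ`-almost every `r : ℕ → ℝ`, distinct finitely
supported multiplicity vectors `a ≠ a'` yield distinct sums `∑ n, a n * r n ≠ ∑ n, a' n * r n`. -/
theorem ae_sum_aggregation_injective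
    (μ : Measure (ℕ → ℝ)) [IsProbabilityMeasure μ]
    (hμ : ∀ s : Finset ℕ, ∀ t : ℕ → Set ℝ, (∀ i, MeasurableSet (t i)) →
      μ {r : ℕ → ℝ | ∀ i ∈ s, r i ∈ t i} =
        ∏ i ∈ s, volume.restrict (Set.Icc (0 : ℝ) 1) (t i)) :
    ∀ᵐ r ∂μ, ∀ a a' : ℕ →₀ ℕ,
      (a.sum fun n k => (k : ℝ) * r n) = (a'.sum fun n k => (k : ℝ) * r n) → a = a' := by
  refine ae_all_iff.mpr fun a => ae_all_iff.mpr fun a' => ?_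
  by_cases h : a = a'
  · exact .of_forall fun _ _ => h
  let s := a.support ∪ a'.support
  have hd : (fun i : s => (a i : ℝ) - a' i) ≠ 0 := fun h0 => h <| Finsupp.ext fun n => by
    by_cases hn : n ∈ s
    · simpa [sub_eq_zero] using congrFun h0 ⟨n, hn⟩
    · have h_mem : a n = 0 ∧ a' n = 0 := by simpa [s] using hn
      rw [h_mem.1, h_mem.2]
  have h_ae := ae_of_ae_map (by fun_prop)
    ((map_restrict_absolutelyContinuous_volume hμ s).ae_le (ae_sum_mul_ne_zero hd))
  filter_upwards [h_ae] with r hr heq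
  refine absurd ?_ hr
  rw [Finsupp.sum_of_support_subset a (s := s) Finset.subset_union_left _ (by simp),
    Finsupp.sum_of_support_subset a' (s := s) Finset.subset_union_right _ (by simp),
    ← sub_eq_zero, ← Finset.sum_sub_distrib, ← Finset.sum_coe_sort] at heq
  simpa [sub_mul] using heq
end

section
/- Let m be a nonempty finite multiset of real numbers with all elements in [0,1], and let μ denote the minimum element of m. Then, with powers interpreted as real powers, the function r ↦ 1 − (∑_{x∈m} (1−x)^r)^{1/r} tends to μ as the real parameter r tends to +∞. Equivalently, LAF with parameters a = 0, b = 1, c = 1/r, d = r, e = 0, f = 1, α = 1, β = −1, γ = 1, δ = 0 converges to the minimum aggregator in the limit r → ∞. -/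
open Real Filter

/-- The `ℓ^r` norm of a finite family of nonnegative reals tends to its maximum as `r → ∞`. -/
theorem Multiset.tendsto_sum_rpow_rpow_one_div {ι : Type*} (m : Multiset ι) (f : ι → ℝ)
    (hf : ∀ i ∈ m, 0 ≤ f i) {j : ι} (hj : j ∈ m) (hmax : ∀ i ∈ m, f i ≤ f j) :
    Tendsto (fun r : ℝ => ((m.map fun i => f i ^ r).sum) ^ (1 / r)) atTop (nhds (f j)) := by
  have hcard : (0 : ℝ) < m.card := by
    exact_mod_cast Multiset.card_pos_iff_exists_mem.mpr ⟨j, hj⟩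
  have hupper : Tendsto (fun r : ℝ => (m.card : ℝ) ^ (1 / r) * f j) atTop (nhds (f j)) := by
    have hexp : Tendsto (fun r : ℝ => 1 / r) atTop (nhds 0) := by
      simpa using tendsto_inv_atTop_zero (𝕜 := ℝ)
    simpa using (tendsto_const_nhds.rpow hexp (.inl hcard.ne')).mul_const (f j)
  have hroot {r : ℝ} (hr : 0 < r) : (f j ^ r) ^ (1 / r) = f j := by
    rw [one_div, rpow_rpow_inv (hf j hj) hr.ne']
  have hnonneg (r : ℝ) : ∀ y ∈ m.map fun i => f i ^ r, 0 ≤ y := by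
    simpa using fun i hi => rpow_nonneg (hf i hi) r
  refine tendsto_of_tendsto_of_tendsto_of_le_of_le' tendsto_const_nhds hupper ?_ ?_
  · filter_upwards [eventually_gt_atTop 0] with r hr
    have hle : f j ^ r ≤ (m.map fun i => f i ^ r).sum :=
      Multiset.single_le_sum (hnonneg r) _ (Multiset.mem_map_of_mem _ hj)
    calc f j = (f j ^ r) ^ (1 / r) := (hroot hr).symm
      _ ≤ _ := rpow_le_rpow (rpow_nonneg (hf j hj) r) hle (by positivity)
  · filter_upwards [eventually_gt_atTop 0] with r hr
    have hle : (m.map fun i => f i ^ r).sum ≤ m.card * f j ^ r := by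
      have h := Multiset.sum_le_card_nsmul (m.map fun i => f i ^ r) (f j ^ r)
        (by simpa using fun i hi => rpow_le_rpow (hf i hi) (hmax i hi) hr.le)
      simpa using h
    calc ((m.map fun i => f i ^ r).sum) ^ (1 / r) ≤ (m.card * f j ^ r) ^ (1 / r) :=
          rpow_le_rpow (Multiset.sum_nonneg (hnonneg r)) hle (by positivity)
      _ = (m.card : ℝ) ^ (1 / r) * f j := by
          rw [mul_rpow hcard.le (rpow_nonneg (hf j hj) r), hroot hr]

/-- 'Min' row of Table 1: for a nonempty multiset `m` with elements in `[0,1]` and minimum `μ`,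
`1 - (∑_{x ∈ m} (1-x)^r)^(1/r) → μ` as `r → ∞` (powers are real powers), i.e. LAF with
parameters `a = 0`, `b = 1`, `c = 1/r`, `d = r`, `e = 0`, `f = 1`, `α = 1`, `β = -1`,
`γ = 1`, `δ = 0` approximates min asymptotically. -/
theorem LAF_tendsto_min (m : Multiset ℝ) (hne : m ≠ 0)
    (hm : ∀ x ∈ m, x ∈ Set.Icc (0 : ℝ) 1)
    (μ : ℝ) (hμ_mem : μ ∈ m) (hμ_lb : ∀ x ∈ m, μ ≤ x) :
    Tendsto (fun r : ℝ => 1 - ((m.map fun x => (1 - x) ^ r).sum) ^ (1 / r)) atTop (nhds μ) := by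
  have h := Multiset.tendsto_sum_rpow_rpow_one_div m (fun x => 1 - x)
    (fun x hx => sub_nonneg.mpr (hm x hx).2) hμ_mem (fun x hx => sub_le_sub_left (hμ_lb x hx) 1)
  simpa using h.const_sub 1
end

section
/- Let m be a nonempty finite multiset of real numbers with all elements in [0,1] whose maximum element M is strictly positive, and let μ denote the minimum element of m. Then, with powers interpreted as real powers, the function r ↦ (1 − (∑_{x∈m} (1−x)^r)^{1/r}) / (∑_{x∈m} x^r)^{1/r} tends to μ / M as the real parameter r tends to +∞; that is, a suitable LAF parameterization approximates the min/max ratio aggregator asymptotically. -/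
open Real Filter

/-- The `ℓ^r` power sum norm of a multiset of nonnegative reals tends to its maximum. -/
theorem Multiset.tendsto_sum_rpow_rpow_one_div_atTop (s : Multiset ℝ) (hs : ∀ x ∈ s, 0 ≤ x)
    {M : ℝ} (hM_mem : M ∈ s) (hM_ub : ∀ x ∈ s, x ≤ M) :
    Tendsto (fun r : ℝ => ((s.map fun x => x ^ r).sum) ^ (1 / r)) atTop (nhds M) := by
  have hM : 0 ≤ M := hs M hM_mem
  have hcard : (0 : ℝ) < s.card := by
    exact_mod_cast Multiset.card_pos_iff_exists_mem.2 ⟨M, hM_mem⟩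
  have h_upper : Tendsto (fun r : ℝ => (s.card : ℝ) ^ (1 / r) * M) atTop (nhds M) := by
    have h_exponent : Tendsto (fun r : ℝ => 1 / r) atTop (nhds 0) := by
      simpa using tendsto_inv_atTop_zero (𝕜 := ℝ)
    simpa using (tendsto_const_nhds.rpow h_exponent (Or.inl hcard.ne')).mul_const M
  refine tendsto_of_tendsto_of_tendsto_of_le_of_le' tendsto_const_nhds h_upper ?_ ?_
  · filter_upwards [eventually_gt_atTop 0] with r hr
    have h_le : M ^ r ≤ (s.map fun x => x ^ r).sum := by
      refine Multiset.single_le_sum ?_ _ (Multiset.mem_map_of_mem _ hM_mem)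
      intro y hy
      obtain ⟨x, hx, rfl⟩ := Multiset.mem_map.1 hy
      exact rpow_nonneg (hs x hx) r
    calc M = (M ^ r) ^ (1 / r) := by rw [one_div, rpow_rpow_inv hM hr.ne']
      _ ≤ _ := rpow_le_rpow (rpow_nonneg hM r) h_le (by positivity)
  · filter_upwards [eventually_gt_atTop 0] with r hr
    have h_nonneg : 0 ≤ (s.map fun x => x ^ r).sum := by
      refine Multiset.sum_nonneg fun y hy => ?_
      obtain ⟨x, hx, rfl⟩ := Multiset.mem_map.1 hy
      exact rpow_nonneg (hs x hx) r
    have h_le : (s.map fun x => x ^ r).sum ≤ s.card * M ^ r := by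
      have h := Multiset.sum_le_card_nsmul (s.map fun x => x ^ r) (M ^ r) fun y hy => by
        obtain ⟨x, hx, rfl⟩ := Multiset.mem_map.1 hy
        exact rpow_le_rpow (hs x hx) (hM_ub x hx) hr.le
      simpa using h
    calc _ ≤ (s.card * M ^ r) ^ (1 / r) := rpow_le_rpow h_nonneg h_le (by positivity)
      _ = (s.card : ℝ) ^ (1 / r) * M := by
        rw [mul_rpow hcard.le (rpow_nonneg hM r), one_div, rpow_rpow_inv hM hr.ne']

/-- 'Min/max' row of Table 1 (with both limit parameters taken equal): for a nonempty
multiset `m` with elements in `[0,1]`, minimum `μ`, and strictly positive maximum `M`,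
`(1 - (∑_{x ∈ m} (1-x)^r)^(1/r)) / (∑_{x ∈ m} x^r)^(1/r) → μ / M` as `r → ∞`
(powers are real powers); a suitable LAF parameterization approximates min/max asymptotically. -/
theorem LAF_tendsto_min_div_max (m : Multiset ℝ) (hne : m ≠ 0)
    (hm : ∀ x ∈ m, x ∈ Set.Icc (0 : ℝ) 1)
    (μ M : ℝ) (hμ_mem : μ ∈ m) (hμ_lb : ∀ x ∈ m, μ ≤ x)
    (hM_mem : M ∈ m) (hM_ub : ∀ x ∈ m, x ≤ M) (hM_pos : 0 < M) :
    Tendsto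
      (fun r : ℝ =>
        (1 - ((m.map fun x => (1 - x) ^ r).sum) ^ (1 / r)) /
          ((m.map fun x => x ^ r).sum) ^ (1 / r))
      atTop (nhds (μ / M)) := by
  have h_max := m.tendsto_sum_rpow_rpow_one_div_atTop (fun x hx => (hm x hx).1) hM_mem hM_ub
  have h_min := (m.map fun x => 1 - x).tendsto_sum_rpow_rpow_one_div_atTop (M := 1 - μ)
    (by
      intro y hy
      obtain ⟨x, hx, rfl⟩ := Multiset.mem_map.1 hy
      exact sub_nonneg.2 (hm x hx).2)
    (Multiset.mem_map_of_mem _ hμ_mem)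
    (by
      intro y hy
      obtain ⟨x, hx, rfl⟩ := Multiset.mem_map.1 hy
      exact sub_le_sub_left (hμ_lb x hx) 1)
  simp only [Multiset.map_map, Function.comp_def] at h_min
  simpa [Pi.div_def] using (h_min.const_sub 1).div h_max hM_pos.ne'
end

section
/- Let m be a nonempty finite multiset of real numbers with all elements in the half-open interval (0,1], let M denote its maximum element and μ its minimum element. Then, with powers interpreted as real powers, the function r ↦ (∑_{x∈m} x^r)^{1/r} / (1 − (∑_{x∈m} (1−x)^r)^{1/r}) tends to M / μ as the real parameter r tends to +∞; that is, a suitable LAF parameterization approximates the max/min ratio aggregator asymptotically. -/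
open Real Filter

/-- The `ℓ^r` norm of a multiset of nonnegative reals tends to its maximum as `r → ∞`. -/
theorem Multiset.tendsto_sum_rpow_rpow_one_div_s14 (m : Multiset ℝ) (hm : ∀ x ∈ m, 0 ≤ x)
    (M : ℝ) (hM_mem : M ∈ m) (hM_ub : ∀ x ∈ m, x ≤ M) :
    Tendsto (fun r : ℝ => ((m.map fun x => x ^ r).sum) ^ (1 / r)) atTop (nhds M) := by
  have hM : 0 ≤ M := hm M hM_mem
  have hcard : (m.card : ℝ) ≠ 0 :=
    Nat.cast_ne_zero.mpr (Multiset.card_pos_iff_exists_mem.mpr ⟨M, hM_mem⟩).ne'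
  have hinv : Tendsto (fun r : ℝ => 1 / r) atTop (nhds 0) := by
    simpa only [one_div] using tendsto_inv_atTop_zero (𝕜 := ℝ)
  have hupper : Tendsto (fun r : ℝ => (m.card : ℝ) ^ (1 / r) * M) atTop (nhds M) := by
    simpa using (tendsto_const_nhds.rpow hinv (Or.inl hcard)).mul_const M
  have hpow : ∀ r : ℝ, ∀ y ∈ m.map (fun x => x ^ r), 0 ≤ y := by
    intro r y hy
    obtain ⟨x, hx, rfl⟩ := Multiset.mem_map.mp hy
    exact rpow_nonneg (hm x hx) r
  refine tendsto_of_tendsto_of_tendsto_of_le_of_le' tendsto_const_nhds hupper ?_ ?_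
  · filter_upwards [eventually_gt_atTop 0] with r hr
    have hle : M ^ r ≤ (m.map fun x => x ^ r).sum :=
      Multiset.single_le_sum (hpow r) _ (Multiset.mem_map_of_mem _ hM_mem)
    calc M = (M ^ r) ^ (1 / r) := by rw [one_div, rpow_rpow_inv hM hr.ne']
      _ ≤ _ := rpow_le_rpow (rpow_nonneg hM r) hle (by positivity)
  · filter_upwards [eventually_gt_atTop 0] with r hr
    have hle : (m.map fun x => x ^ r).sum ≤ m.card * M ^ r := by
      have h := Multiset.sum_le_card_nsmul (m.map fun x => x ^ r) (M ^ r) (by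
        intro y hy
        obtain ⟨x, hx, rfl⟩ := Multiset.mem_map.mp hy
        exact rpow_le_rpow (hm x hx) (hM_ub x hx) hr.le)
      simpa using h
    calc _ ≤ ((m.card : ℝ) * M ^ r) ^ (1 / r) :=
          rpow_le_rpow (Multiset.sum_nonneg (hpow r)) hle (by positivity)
      _ = (m.card : ℝ) ^ (1 / r) * M := by
          rw [mul_rpow (Nat.cast_nonneg _) (rpow_nonneg hM r), one_div, rpow_rpow_inv hM hr.ne']

/-- 'Max/min' row of Table 1 (with both limit parameters taken equal): for a nonempty
multiset `m` with elements in `(0,1]`, maximum `M` and minimum `μ`,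
`(∑_{x ∈ m} x^r)^(1/r) / (1 - (∑_{x ∈ m} (1-x)^r)^(1/r)) → M / μ` as `r → ∞`
(powers are real powers); a suitable LAF parameterization approximates max/min asymptotically. -/
theorem LAF_tendsto_max_div_min (m : Multiset ℝ) (hne : m ≠ 0)
    (hm : ∀ x ∈ m, x ∈ Set.Ioc (0 : ℝ) 1)
    (M μ : ℝ) (hM_mem : M ∈ m) (hM_ub : ∀ x ∈ m, x ≤ M)
    (hμ_mem : μ ∈ m) (hμ_lb : ∀ x ∈ m, μ ≤ x) :
    Tendsto
      (fun r : ℝ =>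
        ((m.map fun x => x ^ r).sum) ^ (1 / r) /
          (1 - ((m.map fun x => (1 - x) ^ r).sum) ^ (1 / r)))
      atTop (nhds (M / μ)) := by
  have hnum := m.tendsto_sum_rpow_rpow_one_div_s14 (fun x hx => (hm x hx).1.le) M hM_mem hM_ub
  have hden := (m.map fun x => 1 - x).tendsto_sum_rpow_rpow_one_div_s14
    (by
      intro y hy
      obtain ⟨x, hx, rfl⟩ := Multiset.mem_map.mp hy
      exact sub_nonneg.mpr (hm x hx).2)
    (1 - μ) (Multiset.mem_map_of_mem _ hμ_mem)
    (by
      intro y hy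
      obtain ⟨x, hx, rfl⟩ := Multiset.mem_map.mp hy
      exact sub_le_sub_left (hμ_lb x hx) 1)
  simp only [Multiset.map_map, Function.comp_def] at hden
  have hden' := hden.const_sub 1
  rw [sub_sub_cancel] at hden'
  exact hnum.div hden' (hm μ hμ_mem).1.ne'
end
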